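/- Let A be a deformation quantization of A₁ over W_n(k) for some n ≥ 1, with structural isomorphism ψ : A/pA ≅ A₁. Then every two-sided ideal I of A that is flat as a W_n(k)-module is generated by its central elements; that is, I equals the two-sided ideal of A generated by the set I ∩ Z(A), where Z(A) is the center of A. -/

import Mathlib

universe u

open scoped TensorProduct

/-- A symplectic Poisson structure on a commutative `k`-algebra `S`: a `k`-bilinear,
antisymmetric bracket which is a derivation in each argument, satisfies the Jacobi identity,
and is nondegenerate in the sense that the `S`-linear map `ι : Ω¹_{S/k} → Der_k(S,S)`
determined by `ι(g·df) = g·{f,·}` is bijective. -/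
structure SymplecticPoisson (k S : Type u) [CommRing k] [CommRing S] [Algebra k S] where
  bracket : S → S → S
  add_left : ∀ x y z : S, bracket (x + y) z = bracket x z + bracket y z
  smul_left : ∀ (c : k) (x z : S), bracket (c • x) z = c • bracket x z
  antisymm : ∀ x y : S, bracket x y = - bracket y x
  leibniz : ∀ x y z : S, bracket x (y * z) = bracket x y * z + y * bracket x z
  jacobi : ∀ x y z : S,
    bracket x (bracket y z) + bracket y (bracket z x) + bracket z (bracket x y) = 0
  nondeg : ∃ ι : KaehlerDifferential k S ≃ₗ[S] Derivation k S S,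
    ∀ f g x : S, ι (g • KaehlerDifferential.D k S f) x = g * bracket f x

/-- The natural map `A ⊗[S] Aᵐᵒᵖ → End_S(A)`, `a ⊗ b ↦ (x ↦ a·x·b)`. -/
noncomputable def mulLeftRightMap (S : Type u) (A : Type*) [CommRing S] [Ring A]
    [Algebra S A] : A ⊗[S] Aᵐᵒᵖ →ₗ[S] Module.End S A :=
  TensorProduct.lift <| LinearMap.mk₂ S
    (fun a b => (LinearMap.mulRight S b.unop) ∘ₗ (LinearMap.mulLeft S a))
    (fun a₁ a₂ b => by ext x; simp [add_mul])
    (fun s a b => by ext x; simp [smul_mul_assoc])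
    (fun a b₁ b₂ => by ext x; simp [mul_add])
    (fun s a b => by ext x; simp [mul_smul_comm])

/-- `A` is an Azumaya algebra over `S`: a finitely generated faithful projective `S`-module
such that the natural map `A ⊗[S] Aᵐᵒᵖ → End_S(A)` is bijective. -/
def IsAzumayaOver (S : Type u) (A : Type*) [CommRing S] [Ring A] [Algebra S A] : Prop :=
  Module.Finite S A ∧ Module.Projective S A ∧ FaithfulSMul S A ∧
    Function.Bijective (mulLeftRightMap S A)


/-! ### Flat modules over truncated Witt vectors -/

theorem TruncatedWittVector.exists_eq_pow_mul {p : ℕ} [Fact p.Prime] {k : Type*} [Field k]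
    [CharP k p] [ExpChar k p] [PerfectRing k p] {n i : ℕ} {w : TruncatedWittVector p n k}
    (h : (p : TruncatedWittVector p n k) ^ i * w = 0) :
    ∃ u, w = (p : TruncatedWittVector p n k) ^ (n - i) * u := by
  obtain ⟨W, rfl⟩ := WittVector.truncate_surjective p n k w
  have h' : W * (p : WittVector p k) ^ i ∈ RingHom.ker (WittVector.truncate (p := p) n) := by
    rw [RingHom.mem_ker, map_mul, map_pow, map_natCast, mul_comm, h]
  rw [WittVector.mem_ker_truncate] at h'
  have hW : W ∈ Ideal.span {((p : WittVector p k) ^ (n - i))} := by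
    rw [WittVector.mem_span_p_pow_iff_le_coeff_eq_zero]
    intro m hm
    have := h' (m + i) (by omega)
    rw [WittVector.mul_pow_charP_coeff_succ] at this
    exact pow_eq_zero_iff (pow_ne_zero _ (Fact.out : p.Prime).ne_zero) |>.1 this
  obtain ⟨U, rfl⟩ := Ideal.mem_span_singleton.1 hW
  exact ⟨WittVector.truncate n U, by simp⟩

theorem TruncatedWittVector.natCast_pow_eq_zero (p : ℕ) [Fact p.Prime] (k : Type*) [Field k]
    [CharP k p] (n : ℕ) : (p : TruncatedWittVector p n k) ^ n = 0 := by
  have h : (1 * (p : WittVector p k) ^ n) ∈ RingHom.ker (WittVector.truncate (p := p) n) := by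
    rw [WittVector.mem_ker_truncate]
    exact fun i hi => WittVector.mul_pow_charP_coeff_zero _ hi
  simpa using h

theorem Module.Flat.exists_eq_smul_of_smul_eq_zero {R M : Type*} [CommRing R] [AddCommGroup M]
    [Module R M] [Module.Flat R M] {r s : R} (h : ∀ w, r * w = 0 → ∃ u, w = s * u) {x : M}
    (hx : r • x = 0) : ∃ y, x = s • y := by
  obtain ⟨l, a, y, hxy, hra⟩ := Module.Flat.isTrivialRelation_of_sum_smul_eq_zero (R := R) (M := M)
    (ι := Unit) (f := fun _ => r) (x := fun _ => x) (by simpa using hx)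
  choose u hu using fun j => h (a () j) (by simpa using hra j)
  refine ⟨∑ j, u j • y j, ?_⟩
  refine (hxy ()).trans ?_
  rw [Finset.smul_sum]
  exact Finset.sum_congr rfl fun j _ => by rw [smul_smul, ← hu]

theorem exists_eq_pow_smul_of_flat {p : ℕ} [Fact p.Prime] {k : Type*} [Field k]
    [CharP k p] [ExpChar k p] [PerfectRing k p] {n : ℕ} {M : Type*} [AddCommGroup M]
    [Module (TruncatedWittVector p n k) M] [Module.Flat (TruncatedWittVector p n k) M] {i : ℕ}
    {x : M} (hx : (p ^ i : ℕ) • x = 0) : ∃ y, x = (p ^ (n - i) : ℕ) • y := by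
  obtain ⟨y, hy⟩ := Module.Flat.exists_eq_smul_of_smul_eq_zero (R := TruncatedWittVector p n k)
    (r := (p : TruncatedWittVector p n k) ^ i) (s := (p : TruncatedWittVector p n k) ^ (n - i))
    (fun w hw => TruncatedWittVector.exists_eq_pow_mul hw) (x := x)
    (by rw [← Nat.cast_pow, Nat.cast_smul_eq_nsmul, hx])
  exact ⟨y, by rw [hy, ← Nat.cast_pow, Nat.cast_smul_eq_nsmul]⟩

/-! ### Two-sided ideals of Azumaya algebras -/

section Azumaya

variable {S : Type u} {B : Type*} [CommRing S] [Ring B] [Algebra S B]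

theorem mulLeftRightMap_mem {K : Ideal B} (hK : ∀ x ∈ K, ∀ a : B, x * a ∈ K) (t : B ⊗[S] Bᵐᵒᵖ)
    {x : B} (hx : x ∈ K) : mulLeftRightMap S B t x ∈ K := by
  induction t with
  | zero => simp
  | add t t' h h' => simpa using K.add_mem h h'
  | tmul a b => simpa [mulLeftRightMap] using hK _ (K.mul_mem_left a hx) b.unop

theorem mulLeftRightMap_sub_mul_mem {K : Ideal B} (hK : ∀ x ∈ K, ∀ a : B, x * a ∈ K) {y : B}
    (hy : ∀ a : B, y * a - a * y ∈ K) (t : B ⊗[S] Bᵐᵒᵖ) :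
    mulLeftRightMap S B t y - y * mulLeftRightMap S B t 1 ∈ K := by
  induction t with
  | zero => simp
  | add t t' h h' =>
    have := K.add_mem h h'
    simp only [map_add, LinearMap.add_apply, mul_add]
    convert this using 1
    abel
  | tmul a b =>
    have := hK _ (K.neg_mem (hy a)) b.unop
    simp only [mulLeftRightMap, TensorProduct.lift.tmul, LinearMap.mk₂_apply,
      LinearMap.comp_apply, LinearMap.mulRight_apply, LinearMap.mulLeft_apply, mul_one]
    convert this using 1
    noncomm_ring

/-- A two-sided ideal of an Azumaya algebra is generated by its intersection with the base. -/
theorem IsAzumayaOver.mem_span_algebraMap (h : IsAzumayaOver S B) {K : Ideal B}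
    (hK : ∀ x ∈ K, ∀ a : B, x * a ∈ K) {x : B} (hx : x ∈ K) :
    x ∈ Ideal.span (algebraMap S B '' (K.comap (algebraMap S B) : Set S)) := by
  obtain ⟨_, hproj, _, _, hsurj⟩ := h
  obtain ⟨s, hs⟩ := (Module.projective_def (R := S) (P := B)).1 hproj
  have hx' : x = (s x).sum fun b c => algebraMap S B c * b := by
    conv_lhs => rw [← hs x]
    simp [Finsupp.linearCombination_apply, Algebra.smul_def]
  rw [hx']
  refine Submodule.sum_mem _ fun b _ => ?_
  change algebraMap S B (s x b) * b ∈ _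
  rw [Algebra.commutes]
  refine Ideal.mul_mem_left _ _ (Ideal.subset_span ⟨_, ?_, rfl⟩)
  obtain ⟨t, ht⟩ := hsurj
    ((LinearMap.toSpanSingleton S B 1) ∘ₗ (Finsupp.lapply b) ∘ₗ s)
  have := mulLeftRightMap_mem hK t hx
  rw [ht] at this
  simpa [Algebra.algebraMap_eq_smul_one] using this

theorem IsAzumayaOver.exists_linearMap_one (h : IsAzumayaOver S B) :
    ∃ ε : B →ₗ[S] S, ε 1 = 1 := by
  obtain ⟨_, hproj, _, _⟩ := h
  obtain ⟨s, hs⟩ := (Module.projective_def (R := S) (P := B)).1 hproj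
  let T : Ideal S := LinearMap.range (LinearMap.applyₗ (R := S) (M := B) (M₂ := S) 1)
  have hT : ∀ x : B, x ∈ T • (⊤ : Submodule S B) := by
    intro x
    have h1 : (1 : B) ∈ T • (⊤ : Submodule S B) := by
      rw [← hs 1, Finsupp.linearCombination_apply]
      refine Submodule.sum_mem _ fun b _ => Submodule.smul_mem_smul ?_ trivial
      exact ⟨(Finsupp.lapply b) ∘ₗ s, by simp⟩
    have := Submodule.mem_map_of_mem (f := LinearMap.mulLeft S x) h1
    rw [Submodule.map_smul''] at this
    simpa using Submodule.smul_mono le_rfl le_top this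
  obtain ⟨r, hr, hr'⟩ := Submodule.exists_sub_one_mem_and_smul_eq_zero_of_fg_of_le_smul T
    (⊤ : Submodule S B) (Module.Finite.fg_top) (fun x _ => hT x)
  have hr0 : r = 0 := eq_of_smul_eq_smul (α := B) fun a => by rw [hr' a trivial, zero_smul]
  subst hr0
  have : (1 : S) ∈ T := by simpa using T.neg_mem hr
  exact this

/-- The center of `B / K` is the image of `S`. -/
theorem IsAzumayaOver.exists_sub_algebraMap_mem (h : IsAzumayaOver S B) {K : Ideal B}
    (hK : ∀ x ∈ K, ∀ a : B, x * a ∈ K) {y : B} (hy : ∀ a : B, y * a - a * y ∈ K) :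
    ∃ s : S, y - algebraMap S B s ∈ K := by
  obtain ⟨ε, hε⟩ := h.exists_linearMap_one
  obtain ⟨t, ht⟩ := h.2.2.2.2 ((LinearMap.toSpanSingleton S B 1) ∘ₗ ε)
  have := mulLeftRightMap_sub_mul_mem hK hy t
  rw [ht] at this
  refine ⟨ε y, ?_⟩
  rw [← neg_sub]
  refine K.neg_mem ?_
  simpa [hε, Algebra.algebraMap_eq_smul_one] using this

end Azumaya
/-! ### Commutators with `p`-th powers -/

section Commutator

variable {A : Type*} [Ring A]

theorem exists_pow_add_two_commutator {q r : ℤ} {x b c d : A} (hb : x * b - b * x = q • c)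
    (hc : x * c - c * x = r • d) (hd : ∃ d', x * d - d * x = r • d') (j : ℕ) :
    ∃ e, x ^ (j + 2) * b - b * x ^ (j + 2) =
      q • (((j + 2 : ℕ) : ℤ) • (c * x ^ (j + 1)) +
        (((j + 2).choose 2 : ℕ) : ℤ) • r • (d * x ^ j) + (r * r) • e) := by
  obtain ⟨d', hd⟩ := hd
  rw [sub_eq_iff_eq_add] at hc hd
  induction j with
  | zero =>
    refine ⟨0, ?_⟩
    have h : x ^ 2 * b - b * x ^ 2 = x * (x * b - b * x) + (x * b - b * x) * x := by
      noncomm_ring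
    rw [zero_add, h, hb, mul_smul_comm, hc]
    simp only [smul_mul_assoc, pow_one, pow_zero, mul_one, zero_add, Nat.choose_self]
    module
  | succ j ih =>
    obtain ⟨e, he⟩ := ih
    refine ⟨((j + 2).choose 2 : ℤ) • (d' * x ^ j) + x * e, ?_⟩
    have h : x ^ (j + 3) * b - b * x ^ (j + 3) =
        x * (x ^ (j + 2) * b - b * x ^ (j + 2)) + (x * b - b * x) * x ^ (j + 2) := by
      rw [pow_succ' x (j + 2)]
      generalize x ^ (j + 2) = y
      noncomm_ring
    have hch : (j + 1 + 2).choose 2 = (j + 2) + (j + 2).choose 2 := by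
      rw [Nat.choose_succ_succ' (j + 2) 1, Nat.choose_one_right]
    have h1 : x * (c * x ^ (j + 1)) = c * x ^ (j + 2) + r • (d * x ^ (j + 1)) := by
      rw [← mul_assoc, hc, add_mul, smul_mul_assoc, mul_assoc, ← pow_succ', add_comm]
    have h2 : x * (d * x ^ j) = d * x ^ (j + 1) + r • (d' * x ^ j) := by
      rw [← mul_assoc, hd, add_mul, smul_mul_assoc, mul_assoc, ← pow_succ', add_comm]
    rw [show j + 1 + 2 = j + 3 from rfl] at hch ⊢
    rw [h, he, hb, hch, show j + 1 + 1 = j + 2 from rfl]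
    simp only [mul_smul_comm, mul_add, h1, h2, smul_mul_assoc]
    push_cast
    module

theorem exists_pow_prime_commutator {p : ℕ} (hp : p.Prime) (hp2 : 2 < p) {x : A}
    (hx : ∀ c : A, ∃ d, x * c - c * x = (p : A) * d) {q : ℕ} {b c : A}
    (hb : x * b - b * x = (q : A) * c) :
    ∃ e, x ^ p * b - b * x ^ p = (q * p : A) * (c * x ^ (p - 1) + p * e) := by
  obtain ⟨d, hd⟩ := hx c
  obtain ⟨d', hd'⟩ := hx d
  obtain ⟨e, he⟩ := exists_pow_add_two_commutator (q := q) (r := p) (by simpa using hb)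
    (by simpa using hd) ⟨d', by simpa using hd'⟩ (p - 2)
  obtain ⟨h, hh⟩ : p ∣ p.choose 2 := hp.dvd_choose_self two_ne_zero hp2
  refine ⟨(h : A) * (d * x ^ (p - 2)) + e, ?_⟩
  rw [show p - 2 + 2 = p by omega, show p - 2 + 1 = p - 1 by omega, hh] at he
  rw [he]
  have hq : (q * p : A) = ((q * p : ℤ) : A) := by push_cast; rfl
  rw [hq, ← zsmul_eq_mul]
  simp only [← Int.cast_natCast (R := A), ← zsmul_eq_mul]
  push_cast
  module

/-- If `x` is central modulo `p` and `[x, b] = p c`, then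
`[x ^ p ^ r, b] ≡ p ^ (r + 1) c x ^ (p ^ r - 1)` modulo `p ^ (r + 2)`. -/
theorem exists_pow_prime_pow_commutator {p : ℕ} (hp : p.Prime) (hp2 : 2 < p) {x : A}
    (hx : ∀ c : A, ∃ d, x * c - c * x = (p : A) * d) (r : ℕ) {b c : A}
    (hb : x * b - b * x = (p : A) * c) :
    ∃ e, x ^ p ^ r * b - b * x ^ p ^ r =
      (p : A) ^ (r + 1) * (c * x ^ (p ^ r - 1) + p * e) := by
  induction r generalizing b c with
  | zero => exact ⟨0, by simpa using hb⟩
  | succ r ih =>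
    have hy : ∀ c : A, ∃ d, x ^ p ^ r * c - c * x ^ p ^ r = (p : A) * d := by
      intro c
      obtain ⟨d, hd⟩ := hx c
      obtain ⟨e, he⟩ := ih hd
      exact ⟨_, he.trans (by rw [pow_succ', mul_assoc])⟩
    obtain ⟨e, he⟩ := ih hb
    obtain ⟨e', he'⟩ := exists_pow_prime_commutator hp hp2 hy (q := p ^ (r + 1))
      (he.trans (by rw [Nat.cast_pow]))
    refine ⟨e * (x ^ p ^ r) ^ (p - 1) + e', ?_⟩
    have hexp : p ^ r - 1 + p ^ r * (p - 1) = p ^ (r + 1) - 1 := by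
      have h1 : 0 < p ^ r := pow_pos hp.pos r
      obtain ⟨s, rfl⟩ : ∃ s, p = s + 1 := ⟨p - 1, by have := hp.pos; omega⟩
      rw [pow_succ, Nat.add_sub_cancel, Nat.mul_succ]
      omega
    rw [pow_succ p r, pow_mul, he', Nat.cast_pow, ← pow_succ, add_mul, mul_assoc c, ← pow_mul x,
      ← pow_add, hexp, ← pow_succ p r]
    noncomm_ring

end Commutator
/-! ### Derivations in characteristic `p` -/

section Derivation

theorem Derivation.iterate_mul {R S : Type*} [CommRing R] [CommRing S] [Algebra R S]
    (D : Derivation R S S) (n : ℕ) (a b : S) :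
    D^[n] (a * b) =
      ∑ ij ∈ Finset.HasAntidiagonal.antidiagonal n, n.choose ij.1 • (D^[ij.1] a * D^[ij.2] b) := by
  induction n with
  | zero => simp
  | succ n ih =>
    rw [Function.iterate_succ_apply', ih,
      Finset.sum_antidiagonal_choose_succ_nsmul (fun i j => D^[i] a * D^[j] b), map_sum,
      ← Finset.sum_add_distrib]
    refine Finset.sum_congr rfl fun ij h => ?_
    rw [map_nsmul, D.leibniz, Function.iterate_succ_apply', Function.iterate_succ_apply',
      smul_eq_mul, smul_eq_mul, nsmul_add, mul_comm (D^[ij.2] b),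
      ← Nat.choose_symm_of_eq_add (Finset.HasAntidiagonal.mem_antidiagonal.1 h).symm]

theorem Polynomial.coeff_pow_mul_derivative {R : Type*} [CommRing R] (F : Polynomial R) (m : ℕ) :
    (F ^ m * derivative F).coeff m = (F ^ (m + 1)).coeff (m + 1) := by
  obtain ⟨G, rfl⟩ := Polynomial.map_surjective
    (MvPolynomial.aeval (R := ℤ) (id : R → R)).toRingHom
    (fun r => ⟨MvPolynomial.X r, by simp⟩) F
  have h : (G ^ m * derivative G).coeff m = (G ^ (m + 1)).coeff (m + 1) := by
    have h1 := congrArg (fun P => coeff P m) (derivative_pow_succ G m)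
    simp only [coeff_derivative, mul_assoc, coeff_C_mul] at h1
    have hm : ((m : MvPolynomial R ℤ) + 1) ≠ 0 := by exact_mod_cast Nat.succ_ne_zero m
    rw [mul_comm] at h1
    exact (mul_left_cancel₀ hm h1).symm
  rw [← Polynomial.map_pow, ← Polynomial.map_pow, derivative_map, ← Polynomial.map_mul,
    coeff_map, coeff_map, h]

variable {k S : Type*} [Field k] [CommRing S] [Algebra k S] {p : ℕ}

open Polynomial in
/-- The exponential `∑ Dⁱ(a) tⁱ / i!` of a derivation, truncated at degree `p`. -/
noncomputable def Derivation.truncExp (p : ℕ) (D : Derivation k S S) (a : S) : S[X] :=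
  ∑ i ∈ Finset.range p, Polynomial.monomial i ((i.factorial : k)⁻¹ • D^[i] a)

theorem Derivation.coeff_truncExp (D : Derivation k S S) (a : S) (m : ℕ) :
    (D.truncExp p a).coeff m = if m < p then (m.factorial : k)⁻¹ • D^[m] a else 0 := by
  simp [Derivation.truncExp, Polynomial.coeff_monomial]

section

variable [CharP S p]

theorem Derivation.pow_char_eq_zero (D : Derivation k S S) (a : S) : D (a ^ p) = 0 := by
  rw [D.leibniz_pow, nsmul_eq_mul, CharP.cast_eq_zero, zero_mul]

theorem Derivation.iterate_pow_char_mul (D : Derivation k S S) (n : ℕ) (a b : S) :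
    D^[n] (a ^ p * b) = a ^ p * D^[n] b := by
  induction n with
  | zero => rfl
  | succ n ih =>
    rw [Function.iterate_succ_apply', ih, D.leibniz, D.pow_char_eq_zero, smul_zero, add_zero,
      smul_eq_mul, Function.iterate_succ_apply']

variable [Fact p.Prime]

/-- The `p`-th power of a derivation in characteristic `p`. -/
def Derivation.powChar (p : ℕ) [Fact p.Prime] [CharP S p] (D : Derivation k S S) :
    Derivation k S S :=
  .mk' ((D : S →ₗ[k] S) ^ p) fun a b => by
    have hp : p.Prime := Fact.out
    have hpS : (p : S) = 0 := CharP.cast_eq_zero S p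
    have h := D.iterate_mul p a b
    rw [Finset.Nat.sum_antidiagonal_eq_sum_range_succ_mk, Finset.sum_range_succ,
      ← Nat.succ_pred_eq_of_pos hp.pos, Finset.sum_range_succ', Finset.sum_eq_zero] at h
    · simp only [Module.End.pow_apply]
      rw [Nat.succ_pred_eq_of_pos hp.pos] at h
      simpa [mul_comm, add_comm] using h
    · intro i hi
      obtain ⟨c, hc⟩ : p ∣ p.choose (i + 1) := hp.dvd_choose_self (by omega) (by
        have := Finset.mem_range.1 hi
        have := Nat.succ_pred_eq_of_pos hp.pos
        omega)
      rw [Nat.succ_pred_eq_of_pos hp.pos, hc, nsmul_eq_mul, Nat.cast_mul, hpS, zero_mul, zero_mul]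

theorem Derivation.powChar_apply (D : Derivation k S S) (a : S) : D.powChar p a = D^[p] a := by
  change ((D : S →ₗ[k] S) ^ p) a = _
  rw [Module.End.pow_apply]
  rfl

end

variable [Fact p.Prime] [CharP k p]

theorem factorial_ne_zero_of_lt_char {m : ℕ} (hm : m < p) : (m.factorial : k) ≠ 0 := by
  rw [Ne, CharP.cast_eq_zero_iff k p, (Fact.out : p.Prime).dvd_factorial]
  omega

open Polynomial in
theorem Derivation.truncExp_mul (D : Derivation k S S) (a b : S) :
    (X : S[X]) ^ p ∣ D.truncExp p (a * b) - D.truncExp p a * D.truncExp p b := by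
  rw [X_pow_dvd_iff]
  intro m hm
  rw [coeff_sub, sub_eq_zero, coeff_mul, coeff_truncExp, if_pos hm, D.iterate_mul,
    Finset.smul_sum]
  refine Finset.sum_congr rfl fun ij h => ?_
  have hij := Finset.HasAntidiagonal.mem_antidiagonal.1 h
  rw [coeff_truncExp, coeff_truncExp, if_pos (by omega), if_pos (by omega), smul_mul_smul_comm,
    ← Nat.cast_smul_eq_nsmul k, smul_smul]
  congr 1
  have h1 := factorial_ne_zero_of_lt_char (k := k) hm
  have h2 := factorial_ne_zero_of_lt_char (k := k) (p := p) (m := ij.1) (by omega)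
  have h3 := factorial_ne_zero_of_lt_char (k := k) (p := p) (m := ij.2) (by omega)
  have h4 : ((ij.1 + ij.2).choose ij.1 * ij.1.factorial * ij.2.factorial : k) =
      (ij.1 + ij.2).factorial := by
    rw [Nat.choose_symm_add]
    exact mod_cast congrArg (Nat.cast (R := k))
      (Nat.add_choose_mul_factorial_mul_factorial ij.1 ij.2)
  rw [hij] at h4
  field_simp
  rw [← h4]

open Polynomial in
theorem Derivation.truncExp_pow (D : Derivation k S S) (a : S) (n : ℕ) :
    (X : S[X]) ^ p ∣ D.truncExp p (a ^ n) - D.truncExp p a ^ n := by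
  induction n with
  | zero =>
    rw [X_pow_dvd_iff]
    intro m hm
    rw [coeff_sub, pow_zero, pow_zero, coeff_truncExp, if_pos hm, coeff_one]
    rcases m with _ | m
    · simp
    · rw [Function.iterate_succ_apply, D.map_one_eq_zero, iterate_map_zero]
      simp
  | succ n ih =>
    have h := dvd_add (D.truncExp_mul (p := p) (a ^ n) a) (ih.mul_right (D.truncExp p a))
    rw [pow_succ, pow_succ]
    convert h using 1
    ring

variable [CharP S p]

open Polynomial in
/-- Hochschild's identity: `fᵖ⁻¹ Dᵖ f - Dᵖ⁻¹ (fᵖ⁻¹ D f) = (D f)ᵖ`. -/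
theorem Derivation.pow_mul_iterate_sub_iterate (D : Derivation k S S) (f : S) :
    f ^ (p - 1) * D^[p] f - D^[p - 1] (f ^ (p - 1) * D f) = D f ^ p := by
  have hp : p.Prime := Fact.out
  have hp1 : 0 < p := hp.pos
  have hp2 := hp.two_le
  have hwil : (((p - 1).factorial : k))⁻¹ = -1 := by
    have := congrArg (ZMod.castHom dvd_rfl k) (ZMod.wilsons_lemma p)
    simp only [_root_.map_natCast, map_neg, map_one] at this
    rw [this, inv_neg, inv_one]
  have hder : D.truncExp p (D f) = derivative (D.truncExp p f) - C (D^[p] f) * X ^ (p - 1) := by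
    ext m
    rw [coeff_sub, coeff_C_mul_X_pow, coeff_derivative, coeff_truncExp, coeff_truncExp,
      ← Function.iterate_succ_apply]
    rcases lt_trichotomy (m + 1) p with h | h | h
    · have h1 := factorial_ne_zero_of_lt_char (k := k) h
      have h2 : ((m : k) + 1) ≠ 0 := by
        rw [Nat.factorial_succ] at h1
        push_cast at h1
        exact left_ne_zero_of_mul h1
      rw [if_pos (by omega), if_pos h, if_neg (by omega), sub_zero, mul_comm,
        show (m : S) + 1 = algebraMap k S (m + 1) by simp, ← Algebra.smul_def, smul_smul,
        Nat.factorial_succ]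
      congr 1
      push_cast
      field_simp
    · obtain rfl : m = p - 1 := by omega
      rw [if_pos (by omega), if_neg (by omega), if_pos rfl, hwil]
      simp [Nat.sub_add_cancel hp1]
    · rw [if_neg (by omega), if_neg (by omega), if_neg (by omega)]
      simp
  have h1 : ∀ m < p, ∀ P Q : S[X], X ^ p ∣ P - Q → P.coeff m = Q.coeff m := by
    intro m hm P Q h
    rw [X_pow_dvd_iff] at h
    simpa [sub_eq_zero] using h m hm
  have h2 := h1 (p - 1) (by omega) _ _ (D.truncExp_mul (p := p) (f ^ (p - 1)) (D f))
  have h3 := h1 (p - 1) (by omega) (D.truncExp p (f ^ (p - 1)) * D.truncExp p (D f))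
    (D.truncExp p f ^ (p - 1) * D.truncExp p (D f)) (by
      rw [← sub_mul]
      exact (D.truncExp_pow f _).mul_right _)
  have h4 : (D.truncExp p f ^ p).coeff p = D f ^ p := by
    rw [← map_frobenius_expand p, coeff_map]
    have := coeff_expand_mul hp1 (D.truncExp p f) 1
    rw [one_mul] at this
    rw [this]
    simp [frobenius_def, coeff_truncExp, hp.one_lt]
  have h5 : (D.truncExp p f ^ (p - 1) * X ^ (p - 1)).coeff (p - 1) = f ^ (p - 1) := by
    rw [coeff_mul_X_pow', if_pos le_rfl, Nat.sub_self, coeff_zero_eq_eval_zero, eval_pow,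
      ← coeff_zero_eq_eval_zero, coeff_truncExp, if_pos hp1]
    simp
  have h6 := coeff_pow_mul_derivative (D.truncExp p f) (p - 1)
  rw [Nat.sub_add_cancel hp1, h4] at h6
  rw [h3, hder, mul_sub, coeff_sub, h6, mul_left_comm, coeff_C_mul, h5, coeff_truncExp,
    if_pos (by omega), hwil, neg_smul, one_smul] at h2
  linear_combination h2

end Derivation
/-! ### Differential ideals in characteristic `p` -/

section DifferentialIdeal

/-- An ideal which is stable under all `k`-derivations. -/
def Ideal.IsDifferential (k : Type*) {S : Type*} [CommRing k] [CommRing S] [Algebra k S]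
    (J : Ideal S) : Prop :=
  ∀ D : Derivation k S S, ∀ f ∈ J, D f ∈ J

variable {k S : Type*} [Field k] [CommRing S] [Algebra k S] {p : ℕ} [Fact p.Prime]
  [CharP k p] [CharP S p]

theorem Ideal.IsDifferential.sum_pow_char_mem {J : Ideal S} (hJ : J.IsDifferential k)
    (s : ℕ → S) (m : ℕ)
    (h : ∀ D : Derivation k S S, ∑ i ∈ Finset.range (m + 1), s i ^ (p ^ i - 1) * D (s i) ∈ J)
    (D : Derivation k S S) :
    (∑ i ∈ Finset.range m, s (i + 1) ^ (p ^ i - 1) * D (s (i + 1))) ^ p ∈ J := by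
  have hp : p.Prime := Fact.out
  have hiter : ∀ n : ℕ, ∀ f ∈ J, D^[n] f ∈ J := by
    intro n f hf
    induction n with
    | zero => exact hf
    | succ n ih => exact (Function.iterate_succ_apply' D n f).symm ▸ hJ D _ ih
  have hsum : ∀ (n : ℕ) (u : ℕ → S) (t : Finset ℕ),
      D^[n] (∑ i ∈ t, u i) = ∑ i ∈ t, D^[n] (u i) := by
    intro n u t
    have h1 := map_sum ((D : S →ₗ[k] S) ^ n) u t
    simp only [Module.End.pow_apply] at h1
    exact h1
  have key : (∑ i ∈ Finset.range m, s (i + 1) ^ (p ^ i - 1) * D (s (i + 1))) ^ p =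
      (∑ i ∈ Finset.range (m + 1), s i ^ (p ^ i - 1) * D.powChar p (s i)) -
        D^[p - 1] (∑ i ∈ Finset.range (m + 1), s i ^ (p ^ i - 1) * D (s i)) := by
    have h0 : D^[p] (s 0) = D^[p - 1] (D (s 0)) := by
      rw [← Function.iterate_succ_apply, Nat.succ_eq_add_one, Nat.sub_add_cancel hp.pos]
    rw [hsum, ← Finset.sum_sub_distrib, Finset.sum_range_succ', sum_pow_char]
    simp only [D.powChar_apply, pow_zero, Nat.sub_self, one_mul, h0, sub_self, add_zero]
    refine Finset.sum_congr rfl fun i _ => ?_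
    have h1 : p ^ (i + 1) - 1 = (p ^ i - 1) * p + (p - 1) := by
      have := Nat.one_le_pow i p hp.pos
      rw [Nat.sub_mul, one_mul, ← pow_succ]
      have : p ≤ p ^ (i + 1) := Nat.le_self_pow (Nat.succ_ne_zero i) p
      have := hp.pos
      omega
    rw [h1, pow_add, pow_mul, mul_assoc, mul_assoc, D.iterate_pow_char_mul, ← mul_sub,
      D.pow_mul_iterate_sub_iterate, mul_pow]
  rw [key]
  exact J.sub_mem (h _) (hiter _ _ (h D))

end DifferentialIdeal

/-! ### Differential ideals in polynomial rings -/

namespace MvPolynomial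

variable {σ k : Type*} [Field k] {p : ℕ} [Fact p.Prime] [CharP k p]

theorem coeff_X_mul_pderiv (a : σ) (f : MvPolynomial σ k) (m : σ →₀ ℕ) :
    coeff m (X a * pderiv a f) = (m a : k) * coeff m f := by
  classical
  induction f using MvPolynomial.induction_on' with
  | monomial u c =>
    rw [X_mul_pderiv_monomial, coeff_smul, coeff_monomial]
    split_ifs with h
    · rw [h, nsmul_eq_mul]
    · simp
  | add f g hf hg => rw [map_add, mul_add, coeff_add, hf, hg, coeff_add, mul_add]

theorem exists_eq_pow_char [PerfectRing k p] (f : MvPolynomial σ k)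
    (hf : ∀ m, coeff m f ≠ 0 → ∀ i, p ∣ m i) : ∃ g, f = g ^ p := by
  have hp : p.Prime := Fact.out
  choose r hr using fun c : k => surjective_frobenius k p c
  refine ⟨∑ m ∈ f.support, monomial (m.mapRange (· / p) (Nat.zero_div p)) (r (coeff m f)), ?_⟩
  conv_lhs => rw [f.as_sum]
  rw [sum_pow_char]
  refine Finset.sum_congr rfl fun m hm => ?_
  rw [monomial_pow, ← frobenius_def, hr]
  congr 2
  ext i
  simp [Nat.mul_div_cancel' (hf m (mem_support_iff.1 hm) i)]

theorem exists_sub_pow_char_mem [Finite σ] [PerfectRing k p] {T : Ideal (MvPolynomial σ k)}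
    (hT : ∀ i, ∀ f ∈ T, pderiv i f ∈ T) {f : MvPolynomial σ k} (hf : ∀ i, pderiv i f ∈ T) :
    ∃ g, f - g ^ p ∈ T := by
  classical
  have hp : p.Prime := Fact.out
  have key : ∀ s : Finset σ, ∃ f', f - f' ∈ T ∧ ∀ m, coeff m f' ≠ 0 → ∀ i ∈ s, p ∣ m i := by
    intro s
    induction s using Finset.induction_on with
    | empty => exact ⟨f, by simp, by simp⟩
    | insert a s _ ih =>
      obtain ⟨f', hf', hs⟩ := ih
      let θ : MvPolynomial σ k → MvPolynomial σ k := fun g => X a * pderiv a g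
      have hθ : ∀ (j : ℕ) g m, coeff m (θ^[j] g) = (m a : k) ^ j * coeff m g := by
        intro j g m
        induction j with
        | zero => simp
        | succ j ih =>
          rw [Function.iterate_succ_apply', coeff_X_mul_pderiv, ih, pow_succ']
          ring
      have hθT : ∀ (j : ℕ), θ^[j + 1] f' ∈ T := by
        intro j
        induction j with
        | zero =>
          have h := T.sub_mem (hf a) (hT a _ hf')
          rw [map_sub, sub_sub_cancel] at h
          exact T.mul_mem_left _ h
        | succ j ih =>
          rw [Function.iterate_succ_apply']
          exact T.mul_mem_left _ (hT a _ ih)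
      refine ⟨f' - θ^[p - 1] f', ?_, ?_⟩
      · have h := hθT (p - 2)
        rw [show p - 2 + 1 = p - 1 by have := hp.two_le; omega] at h
        have := T.add_mem hf' h
        convert this using 1
        ring
      · intro m hm i hi
        have hc : coeff m (f' - θ^[p - 1] f') = (1 - (m a : k) ^ (p - 1)) * coeff m f' := by
          rw [coeff_sub, hθ]
          ring
        rw [hc] at hm
        rcases Finset.mem_insert.1 hi with rfl | hi
        · by_contra hd
          apply left_ne_zero_of_mul hm
          have h1 : ((m i : ℕ) : ZMod p) ≠ 0 := by rwa [Ne, ZMod.natCast_eq_zero_iff]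
          have := congrArg (ZMod.castHom dvd_rfl k) (ZMod.pow_card_sub_one_eq_one h1)
          simp only [map_pow, map_natCast, map_one] at this
          rw [this, sub_self]
        · exact hs m (right_ne_zero_of_mul hm) i hi
  have := Fintype.ofFinite σ
  obtain ⟨f', hf', h⟩ := key Finset.univ
  obtain ⟨g, rfl⟩ := exists_eq_pow_char f' fun m hm i => h m hm i (Finset.mem_univ i)
  exact ⟨g, hf'⟩

theorem mem_span_pow_char [Finite σ] [PerfectRing k p] {T : Ideal (MvPolynomial σ k)}
    (hT : ∀ i, ∀ f ∈ T, pderiv i f ∈ T) {f : MvPolynomial σ k} (hf : f ∈ T) :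
    f ∈ Ideal.span {h | h ∈ T ∧ ∃ g, h = g ^ p} := by
  set T₀ := Ideal.span {h | h ∈ T ∧ ∃ g, h = g ^ p} with hT₀
  have hle : T₀ ≤ T := Ideal.span_le.2 fun h hh => hh.1
  have hT₀' : ∀ i, ∀ f ∈ T₀, pderiv i f ∈ T₀ := by
    intro i f hf
    induction hf using Submodule.span_induction with
    | mem h hh =>
      obtain ⟨_, g, rfl⟩ := hh
      rw [(pderiv i).pow_char_eq_zero]
      exact T₀.zero_mem
    | zero => simp
    | add f g _ _ hf hg => rw [map_add]; exact T₀.add_mem hf hg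
    | smul a f hf' hf =>
      rw [smul_eq_mul, Derivation.leibniz, smul_eq_mul, smul_eq_mul]
      exact T₀.add_mem (T₀.mul_mem_left _ hf) (T₀.mul_mem_right _ hf')
  have key : ∀ d : ℕ, ∀ f ∈ T, (∀ m, coeff m f ≠ 0 → m.degree < d) → f ∈ T₀ := by
    intro d
    induction d with
    | zero =>
      intro f _ h
      have : f = 0 := by
        ext m
        by_contra hm
        exact absurd (h m hm) (Nat.not_lt_zero _)
      exact this ▸ T₀.zero_mem
    | succ d ih =>
      intro f hf h
      obtain ⟨g, hg⟩ := exists_sub_pow_char_mem (p := p) hT₀' (f := f) fun i => by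
        refine ih _ (hT i f hf) fun m hm => ?_
        rw [coeff_pderiv] at hm
        have := h _ (left_ne_zero_of_mul hm)
        rw [map_add, Finsupp.degree_single] at this
        omega
      have h1 : g ^ p ∈ T := by
        have := T.sub_mem hf (hle hg)
        rwa [sub_sub_cancel] at this
      have := T₀.add_mem hg (Ideal.subset_span ⟨h1, g, rfl⟩)
      rwa [sub_add_cancel] at this
  exact key (f.support.sup Finsupp.degree + 1) f hf fun m hm =>
    Nat.lt_succ_of_le (Finset.le_sup (f := Finsupp.degree) (mem_support_iff.2 hm))

end MvPolynomial

/-! ### Differential ideals in smooth algebras -/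

section Smooth

open KaehlerDifferential

variable {k S : Type*} [CommRing k] [CommRing S] [Algebra k S]

theorem Derivation.apply_mem_map_of_forall_mem [Module.Projective S Ω[S⁄k]]
    {B : Type*} [CommRing B] [Algebra k B] [Algebra S B] [IsScalarTower k S B]
    {J : Ideal S} {f : S} (hf : ∀ D : Derivation k S S, D f ∈ J) (δ : Derivation k S B) :
    δ f ∈ J.map (algebraMap S B) := by
  obtain ⟨s, hs⟩ := (Module.projective_def (R := S) (P := Ω[S⁄k])).1 inferInstance
  have hd : KaehlerDifferential.D k S f ∈ J • (⊤ : Submodule S Ω[S⁄k]) := by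
    rw [← hs (KaehlerDifferential.D k S f), Finsupp.linearCombination_apply]
    refine Submodule.sum_mem _ fun y _ => Submodule.smul_mem_smul ?_ Submodule.mem_top
    exact hf (((Finsupp.lapply y).comp s).compDer (KaehlerDifferential.D k S))
  have h1 := Submodule.mem_map_of_mem (f := δ.liftKaehlerDifferential) hd
  rw [δ.liftKaehlerDifferential_comp_D, Submodule.map_smul''] at h1
  refine Submodule.smul_induction_on h1 (fun r hr b _ => ?_) fun x y hx hy => Ideal.add_mem _ hx hy
  rw [Algebra.smul_def]
  exact Ideal.mul_mem_right _ _ (Ideal.mem_map_of_mem _ hr)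

end Smooth

section Smooth

variable {k S : Type*} [Field k] [CommRing S] [Algebra k S] [Algebra.FiniteType k S]
  [Algebra.FormallySmooth k S]

/-- A differential ideal `J` of a smooth algebra is the image of an ideal `T` of a polynomial ring
stable under partial derivatives, compatibly with constants modulo `J`. -/
theorem Ideal.IsDifferential.exists_mvPolynomial (p : ℕ) [Fact p.Prime] [CharP k p]
    {J : Ideal S} (hJ : J.IsDifferential k) :
    ∃ (N : ℕ) (ρ : MvPolynomial (Fin N) k →ₐ[k] S) (T : Ideal (MvPolynomial (Fin N) k)),
      (∀ i, ∀ F ∈ T, MvPolynomial.pderiv i F ∈ T) ∧ (∀ F ∈ T, ρ F ∈ J) ∧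
      (∀ f ∈ J, ∃ F ∈ T, ρ F = f) ∧
      ∀ f, (∀ D : Derivation k S S, D f ∈ J) →
        ∃ F, ρ F = f ∧ ∀ i, MvPolynomial.pderiv i F ∈ T := by
  have hp : p.Prime := Fact.out
  obtain ⟨N, ρ, hρ⟩ := Algebra.FiniteType.iff_quotient_mvPolynomial''.1
    (inferInstance : Algebra.FiniteType k S)
  let 𝔟 : Ideal (MvPolynomial (Fin N) k) := Ideal.span {h | ∃ g, ρ g = 0 ∧ h = g ^ p}
  have h𝔟d : ∀ i, ∀ F ∈ 𝔟, MvPolynomial.pderiv i F ∈ 𝔟 := by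
    intro i F hF
    induction hF using Submodule.span_induction with
    | mem h hh =>
      obtain ⟨g, _, rfl⟩ := hh
      rw [(MvPolynomial.pderiv i).pow_char_eq_zero]
      exact 𝔟.zero_mem
    | zero => simp
    | add f g _ _ hf hg => rw [map_add]; exact 𝔟.add_mem hf hg
    | smul a f hf' hf =>
      rw [smul_eq_mul, Derivation.leibniz, smul_eq_mul, smul_eq_mul]
      exact 𝔟.add_mem (𝔟.mul_mem_left _ hf) (𝔟.mul_mem_right _ hf')
  have h𝔟 : ∀ F ∈ 𝔟, ρ F = 0 := by
    have : 𝔟 ≤ RingHom.ker ρ := by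
      rw [Ideal.span_le]
      rintro _ ⟨g, hg, rfl⟩
      rw [SetLike.mem_coe, RingHom.mem_ker, map_pow, hg, zero_pow hp.ne_zero]
    exact fun F hF => this hF
  let q : (MvPolynomial (Fin N) k ⧸ 𝔟) →ₐ[k] S := Ideal.Quotient.liftₐ 𝔟 ρ h𝔟
  have hq : ∀ F, q (Ideal.Quotient.mk 𝔟 F) = ρ F := fun F => rfl
  have hqs : Function.Surjective q := fun s => by
    obtain ⟨F, rfl⟩ := hρ s
    exact ⟨_, hq F⟩
  have hnil : IsNilpotent (RingHom.ker (q : (MvPolynomial (Fin N) k ⧸ 𝔟) →+* S)) := by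
    rw [Ideal.FG.isNilpotent_iff_le_nilradical (IsNoetherian.noetherian _)]
    intro x hx
    obtain ⟨F, rfl⟩ := Ideal.Quotient.mk_surjective x
    refine ⟨p, ?_⟩
    rw [← map_pow, Ideal.zero_eq_bot, Ideal.mem_bot, Ideal.Quotient.eq_zero_iff_mem]
    exact Ideal.subset_span ⟨F, hx, rfl⟩
  let σ : S →ₐ[k] (MvPolynomial (Fin N) k ⧸ 𝔟) :=
    Algebra.FormallySmooth.liftOfSurjective (AlgHom.id k S) q hqs hnil
  have hσ : ∀ s, q (σ s) = s :=
    Algebra.FormallySmooth.liftOfSurjective_apply (AlgHom.id k S) q hqs hnil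
  let _ : Algebra S (MvPolynomial (Fin N) k ⧸ 𝔟) := σ.toRingHom.toAlgebra
  have : IsScalarTower k S (MvPolynomial (Fin N) k ⧸ 𝔟) :=
    IsScalarTower.of_algebraMap_eq fun x => (σ.commutes x).symm
  have hsm : ∀ (s : S) (x : MvPolynomial (Fin N) k ⧸ 𝔟), s • x = σ s * x := fun _ _ => rfl
  have hlift : ∀ s : S, ∃ F, Ideal.Quotient.mk 𝔟 F = σ s := fun s =>
    Ideal.Quotient.mk_surjective _
  have hwd : ∀ i F G, Ideal.Quotient.mk 𝔟 F = Ideal.Quotient.mk 𝔟 G →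
      Ideal.Quotient.mk 𝔟 (MvPolynomial.pderiv i F) =
        Ideal.Quotient.mk 𝔟 (MvPolynomial.pderiv i G) := by
    intro i F G h
    rw [Ideal.Quotient.eq] at h ⊢
    rw [← map_sub]
    exact h𝔟d i _ h
  choose L hL using hlift
  let δ : Fin N → Derivation k S (MvPolynomial (Fin N) k ⧸ 𝔟) := fun i =>
    .mk' { toFun := fun s => Ideal.Quotient.mk 𝔟 (MvPolynomial.pderiv i (L s))
           map_add' := fun s t => by
             rw [← map_add, ← map_add]
             apply hwd
             rw [hL, map_add, map_add, hL, hL]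
           map_smul' := fun c s => by
             rw [RingHom.id_apply, ← Ideal.Quotient.mkₐ_eq_mk k, ← map_smul,
               ← Derivation.map_smul, Ideal.Quotient.mkₐ_eq_mk]
             apply hwd
             rw [hL, ← Ideal.Quotient.mkₐ_eq_mk k, map_smul, map_smul, Ideal.Quotient.mkₐ_eq_mk,
               hL] } fun s t => by
      change Ideal.Quotient.mk 𝔟 (MvPolynomial.pderiv i (L (s * t))) =
        s • Ideal.Quotient.mk 𝔟 (MvPolynomial.pderiv i (L t)) +
          t • Ideal.Quotient.mk 𝔟 (MvPolynomial.pderiv i (L s))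
      rw [hwd i _ (L s * L t) (by rw [hL, map_mul, map_mul, hL, hL]), Derivation.leibniz, map_add,
        smul_eq_mul, smul_eq_mul, map_mul, map_mul, hL, hL, hsm, hsm]
  have hδ : ∀ i F s, Ideal.Quotient.mk 𝔟 F = σ s →
      Ideal.Quotient.mk 𝔟 (MvPolynomial.pderiv i F) = δ i s := fun i F s h =>
    hwd i _ _ (h.trans (hL s).symm)
  let K : Ideal (MvPolynomial (Fin N) k ⧸ 𝔟) := J.map (algebraMap S _)
  have hKδ : ∀ i f, (∀ D : Derivation k S S, D f ∈ J) → δ i f ∈ K := fun i f hf =>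
    Derivation.apply_mem_map_of_forall_mem hf (δ i)
  refine ⟨N, ρ, K.comap (Ideal.Quotient.mk 𝔟), ?_, ?_, ?_, ?_⟩
  · have hstab : ∀ i, ∀ x ∈ K, ∀ F, Ideal.Quotient.mk 𝔟 F = x →
        Ideal.Quotient.mk 𝔟 (MvPolynomial.pderiv i F) ∈ K := by
      intro i x hx
      induction hx using Submodule.span_induction with
      | mem x hx =>
        obtain ⟨j, hj, rfl⟩ := hx
        intro F hF
        rw [hδ i F j hF]
        exact hKδ i j fun D => hJ D j hj
      | zero =>
        intro F hF
        rw [hwd i F 0 (by rw [hF, map_zero]), map_zero, map_zero]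
        exact K.zero_mem
      | add x y _ _ hx hy =>
        intro F hF
        obtain ⟨X, rfl⟩ := Ideal.Quotient.mk_surjective x
        obtain ⟨Y, rfl⟩ := Ideal.Quotient.mk_surjective y
        rw [hwd i F (X + Y) (by rw [hF, map_add]), map_add, map_add]
        exact K.add_mem (hx _ rfl) (hy _ rfl)
      | smul a x hx' hx =>
        intro F hF
        obtain ⟨X, rfl⟩ := Ideal.Quotient.mk_surjective x
        obtain ⟨Y, rfl⟩ := Ideal.Quotient.mk_surjective a
        rw [hwd i F (Y * X) (by rw [hF, map_mul, smul_eq_mul]), Derivation.leibniz, map_add,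
          smul_eq_mul, smul_eq_mul, map_mul, map_mul]
        exact K.add_mem (K.mul_mem_left _ (hx _ rfl)) (K.mul_mem_right _ hx')
    exact fun i F hF => hstab i _ hF F rfl
  · intro F hF
    have hle : K ≤ J.comap q := by
      rw [Ideal.map_le_iff_le_comap]
      intro j hj
      change q (σ j) ∈ J
      rwa [hσ]
    exact hle hF
  · intro f hf
    refine ⟨L f, ?_, by rw [← hq, hL, hσ]⟩
    rw [Ideal.mem_comap, hL]
    exact Ideal.mem_map_of_mem _ hf
  · intro f hf
    refine ⟨L f, by rw [← hq, hL, hσ], fun i => ?_⟩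
    rw [Ideal.mem_comap, hδ i _ f (hL f)]
    exact hKδ i f hf

variable (p : ℕ) [Fact p.Prime] [CharP k p] [PerfectRing k p]

theorem Ideal.IsDifferential.mem_span_pow_char {J : Ideal S} (hJ : J.IsDifferential k) {f : S}
    (hf : f ∈ J) : f ∈ Ideal.span {h | h ∈ J ∧ ∃ g, h = g ^ p} := by
  obtain ⟨N, ρ, T, hT, hTJ, hJT, _⟩ := hJ.exists_mvPolynomial p
  obtain ⟨F, hF, rfl⟩ := hJT f hf
  have h := Ideal.mem_map_of_mem ρ (MvPolynomial.mem_span_pow_char (p := p) hT hF)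
  rw [Ideal.map_span] at h
  refine Ideal.span_mono ?_ h
  rintro _ ⟨_, ⟨h1, g, rfl⟩, rfl⟩
  exact ⟨hTJ _ h1, ρ g, map_pow ρ g p⟩

theorem Ideal.IsDifferential.exists_sub_pow_char_mem {J : Ideal S} (hJ : J.IsDifferential k)
    {f : S} (hf : ∀ D : Derivation k S S, D f ∈ J) : ∃ g, f - g ^ p ∈ J := by
  obtain ⟨N, ρ, T, hT, hTJ, _, h⟩ := hJ.exists_mvPolynomial p
  obtain ⟨F, rfl, hF⟩ := h f hf
  obtain ⟨G, hG⟩ := MvPolynomial.exists_sub_pow_char_mem (p := p) hT hF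
  refine ⟨ρ G, ?_⟩
  rw [← map_pow, ← map_sub]
  exact hTJ _ hG

end Smooth

/-! ### Frobenius preimages of an ideal -/

section Frobenius

variable {k S : Type*} [Field k] [CommRing S] [Algebra k S] {p : ℕ} [Fact p.Prime]
  [CharP S p]

theorem Ideal.mem_comap_iterateFrobenius {J : Ideal S} {i : ℕ} {f : S} :
    f ∈ J.comap (iterateFrobenius S p i) ↔ f ^ p ^ i ∈ J := by
  rw [Ideal.mem_comap, iterateFrobenius_def]

theorem Ideal.derivation_mem_comap_iterateFrobenius [CharP k p] (m : ℕ) {J : Ideal S}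
    (hJ : ∀ i < m, (J.comap (iterateFrobenius S p i)).IsDifferential k) {s : ℕ → S}
    (h : ∀ D : Derivation k S S, ∑ i ∈ Finset.range (m + 1), s i ^ (p ^ i - 1) * D (s i) ∈ J)
    (D : Derivation k S S) : D (s m) ∈ J.comap (iterateFrobenius S p m) := by
  induction m generalizing J s with
  | zero => simpa [Ideal.mem_comap_iterateFrobenius] using h D
  | succ m ih =>
    have hcomp : ∀ i, (J.comap (frobenius S p)).comap (iterateFrobenius S p i) =
        J.comap (iterateFrobenius S p (i + 1)) := by
      intro i
      ext f
      rw [Ideal.mem_comap_iterateFrobenius, Ideal.mem_comap_iterateFrobenius, Ideal.mem_comap,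
        frobenius_def, ← pow_mul, ← pow_succ]
    have hJ0 : J.IsDifferential k := by
      have := hJ 0 (Nat.succ_pos m)
      rwa [iterateFrobenius_zero, Ideal.comap_id] at this
    rw [← hcomp]
    exact ih (J := J.comap (frobenius S p)) (s := fun i => s (i + 1))
      (fun i hi => by rw [hcomp]; exact hJ (i + 1) (Nat.succ_lt_succ hi))
      fun D => hJ0.sum_pow_char_mem s (m + 1) h D

theorem Ideal.mem_span_pow_of_isDifferential [CharP k p] [PerfectRing k p]
    [Algebra.FiniteType k S] [Algebra.FormallySmooth k S] {J : Ideal S} (m : ℕ)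
    (hJ : ∀ i < m, (J.comap (iterateFrobenius S p i)).IsDifferential k) :
    J ≤ Ideal.span {h | h ∈ J ∧ ∃ g, h = g ^ p ^ m} := by
  induction m with
  | zero => exact fun f hf => Ideal.subset_span ⟨hf, f, by simp⟩
  | succ m ih =>
    refine (ih fun i hi => hJ i (hi.trans (Nat.lt_succ_self m))).trans (Ideal.span_le.2 ?_)
    rintro _ ⟨hg, g, rfl⟩
    have h := (hJ m (Nat.lt_succ_self m)).mem_span_pow_char p
      (Ideal.mem_comap_iterateFrobenius.2 hg)
    have h := Ideal.mem_map_of_mem (iterateFrobenius S p m) h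
    rw [Ideal.map_span, iterateFrobenius_def] at h
    refine Ideal.span_mono ?_ h
    rintro _ ⟨_, ⟨h1, c, rfl⟩, rfl⟩
    exact ⟨h1, c, by rw [iterateFrobenius_def, ← pow_mul, pow_succ']⟩

end Frobenius

theorem SymplecticPoisson.sum_derivation_mem {k S : Type u} [CommRing k] [CommRing S]
    [Algebra k S] (P : SymplecticPoisson k S) {J : Ideal S} {ι : Type*} {t : Finset ι}
    {a s : ι → S} (h : ∀ x, ∑ i ∈ t, a i * P.bracket (s i) x ∈ J) (D : Derivation k S S) :
    ∑ i ∈ t, a i * D (s i) ∈ J := by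
  obtain ⟨φ, hφ⟩ := P.nondeg
  obtain ⟨ω, rfl⟩ := φ.surjective D
  have hω : ω ∈ Submodule.span S (Set.range (KaehlerDifferential.D k S)) := by
    rw [KaehlerDifferential.span_range_derivation]
    trivial
  induction hω using Submodule.span_induction with
  | mem ω hω =>
    obtain ⟨x, rfl⟩ := hω
    have h1 := hφ x 1
    simp only [one_smul, one_mul] at h1
    have h2 := J.neg_mem (h x)
    rw [← Finset.sum_neg_distrib] at h2
    convert h2 using 2 with i
    rw [h1, P.antisymm, mul_neg]
  | zero => simp
  | add x y _ _ hx hy =>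
    have := J.add_mem hx hy
    rw [← Finset.sum_add_distrib] at this
    simpa [mul_add] using this
  | smul r x _ hx =>
    have := J.mul_mem_left r hx
    rw [Finset.mul_sum] at this
    simpa [mul_left_comm] using this

/-! ### Ghost elements of a quantization -/

section Quantization

/-- The ghost expression `∑_{i < m} p^{m-1-i} g_i^{p^i}`. -/
def ghostSum {A : Type*} [Ring A] (p : ℕ) (g : ℕ → A) : ℕ → A
  | 0 => 0
  | m + 1 => g m ^ p ^ m + p * ghostSum p g m

variable {S B A : Type*} [CommRing S] [Ring B] [Algebra S B] [Ring A]

/-- `x` is congruent modulo `p ^ m` to a ghost expression in lifts of `s i`. -/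
def IsGhost (p : ℕ) (π : A →+* B) (m : ℕ) (s : ℕ → S) (x : A) : Prop :=
  ∃ g : ℕ → A, (∀ i, π (g i) = algebraMap S B (s i)) ∧
    ∃ a, x = ghostSum p g m + (p : A) ^ m * a

/-- The properties of a deformation quantization `A` of `B` over Witt vectors of length `n`
that do not refer to Witt vectors. -/
structure IsQuantization (p n : ℕ) (br : S → S → S) (π : A →+* B) : Prop where
  algebraMap_injective : Function.Injective (algebraMap S B)
  surjective : Function.Surjective π
  map_eq_zero_iff : ∀ a, π a = 0 ↔ ∃ b, a = (p : A) * b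
  pow_eq_zero : (p : A) ^ n = 0
  exists_eq_pow_mul : ∀ (i : ℕ) (a : A), (p : A) ^ i * a = 0 → ∃ b, a = (p : A) ^ (n - i) * b
  bracket : ∀ (a b : A) (s t : S), π a = algebraMap S B s → π b = algebraMap S B t →
    ∃ c, (p : A) * c = a * b - b * a ∧ π c = algebraMap S B (br s t)

/-- A two-sided ideal of `A` that is flat over Witt vectors of length `n`. -/
structure IsFlatTwoSided (p n : ℕ) (I : Ideal A) : Prop where
  mul_mem : ∀ x ∈ I, ∀ a, x * a ∈ I
  exists_eq_pow_mul : ∀ (i : ℕ), ∀ x ∈ I, (p : A) ^ i * x = 0 →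
    ∃ y ∈ I, x = (p : A) ^ (n - i) * y

variable {p n : ℕ} {br : S → S → S} {π : A →+* B}

theorem ghostSum_congr {g g' : ℕ → A} {m : ℕ} (h : ∀ i < m, g i = g' i) :
    ghostSum p g m = ghostSum p g' m := by
  induction m with
  | zero => rfl
  | succ m ih =>
    rw [ghostSum, ghostSum, h m (Nat.lt_succ_self m), ih fun i hi => h i (Nat.lt_succ_of_lt hi)]

theorem IsQuantization.exists_eq_add (hq : IsQuantization p n br π) {x y : A} (h : π x = π y) :
    ∃ a, x = y + p * a := by
  obtain ⟨a, ha⟩ := (hq.map_eq_zero_iff (x - y)).1 (by rw [map_sub, h, sub_self])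
  exact ⟨a, by rw [← ha, add_sub_cancel]⟩

theorem IsQuantization.map_natCast_eq_zero (hq : IsQuantization p n br π) : π (p : A) = 0 :=
  (hq.map_eq_zero_iff _).2 ⟨1, by rw [mul_one]⟩

theorem isGhost_zero (x : A) :
    IsGhost p π 0 (fun _ => (0 : S)) x :=
  ⟨fun _ => 0, fun _ => by rw [map_zero, map_zero], x, by simp [ghostSum]⟩

theorem IsGhost.pow_add {m : ℕ} {s : ℕ → S} {y : A} (hy : IsGhost p π m s y) {f : A} {t : S}
    (hf : π f = algebraMap S B t) :
    IsGhost p π (m + 1) (Function.update s m t) (f ^ p ^ m + p * y) := by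
  obtain ⟨g, hg, a, rfl⟩ := hy
  refine ⟨Function.update g m f, fun i => ?_, a, ?_⟩
  · rcases eq_or_ne i m with rfl | hi
    · simpa using hf
    · simpa [hi] using hg i
  · have h : ghostSum p (Function.update g m f) m = ghostSum p g m :=
      ghostSum_congr fun i hi => Function.update_of_ne hi.ne _ _
    rw [ghostSum, Function.update_self, h, mul_add, ← mul_assoc, ← pow_succ', add_assoc]

theorem IsGhost.map_eq (hq : IsQuantization p n br π) {m : ℕ} {s : ℕ → S} {x : A}
    (hx : IsGhost p π (m + 1) s x) : π x = algebraMap S B (s m ^ p ^ m) := by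
  obtain ⟨g, hg, a, rfl⟩ := hx
  simp [ghostSum, hq.map_natCast_eq_zero, hg]

theorem IsQuantization.exists_commutator (hq : IsQuantization p n br π) {x : A} {s : S}
    (hx : π x = algebraMap S B s) (c : A) : ∃ d, x * c - c * x = (p : A) * d :=
  (hq.map_eq_zero_iff _).1 (by
    rw [map_sub, map_mul, map_mul, hx, ← Algebra.commutes, sub_self])

theorem ghostSum_commutator (hp : p.Prime) (hp2 : 2 < p) (hq : IsQuantization p n br π)
    {g : ℕ → A} {s : ℕ → S} (hg : ∀ i, π (g i) = algebraMap S B (s i)) (m : ℕ) (b : A) :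
    ∃ c, ghostSum p g m * b - b * ghostSum p g m = (p : A) ^ m * c ∧
      ∀ t, π b = algebraMap S B t →
        π c = algebraMap S B (∑ i ∈ Finset.range m, s i ^ (p ^ i - 1) * br (s i) t) := by
  induction m with
  | zero => exact ⟨0, by simp [ghostSum], by simp⟩
  | succ m ih =>
    obtain ⟨c, hc, hct⟩ := ih
    have h1 : ∃ c', g m * b - b * g m = (p : A) * c' ∧
        ∀ t, π b = algebraMap S B t → π c' = algebraMap S B (br (s m) t) := by
      by_cases hb : ∃ t, π b = algebraMap S B t
      · obtain ⟨t, ht⟩ := hb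
        obtain ⟨c', hc', hct'⟩ := hq.bracket (g m) b (s m) t (hg m) ht
        refine ⟨c', hc'.symm, fun t' ht' => ?_⟩
        rw [hct', hq.algebraMap_injective (ht.symm.trans ht')]
      · obtain ⟨c', hc'⟩ := hq.exists_commutator (hg m) b
        exact ⟨c', hc', fun t ht => absurd ⟨t, ht⟩ hb⟩
    obtain ⟨c', hc', hct'⟩ := h1
    obtain ⟨e, he⟩ := exists_pow_prime_pow_commutator hp hp2 (hq.exists_commutator (hg m)) m hc'
    refine ⟨c' * g m ^ (p ^ m - 1) + p * e + c, ?_, fun t ht => ?_⟩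
    · rw [mul_add, ← he, pow_succ', mul_assoc, ← hc, ghostSum, mul_sub, ← mul_assoc (p : A) b,
        (Nat.cast_commute p b).eq]
      noncomm_ring
    · rw [Finset.sum_range_succ, map_add, map_add, map_mul, map_mul, hct t ht, hct' t ht,
        hq.map_natCast_eq_zero, map_pow, hg, zero_mul, add_zero, ← map_pow, ← map_mul, ← map_add]
      congr 1
      ring

end Quantization
section Ideal

variable {S B A : Type*} [CommRing S] [Ring B] [Algebra S B] [Ring A] {p n : ℕ}
  {br : S → S → S} {π : A →+* B}

theorem IsGhost.commutator (hp : p.Prime) (hp2 : 2 < p) (hq : IsQuantization p n br π) {m : ℕ}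
    {s : ℕ → S} {x : A} (hx : IsGhost p π m s x) (b : A) :
    ∃ c, x * b - b * x = (p : A) ^ m * c ∧
      ∀ t, π b = algebraMap S B t →
        π c = algebraMap S B (∑ i ∈ Finset.range m, s i ^ (p ^ i - 1) * br (s i) t) := by
  obtain ⟨g, hg, a, rfl⟩ := hx
  obtain ⟨c, hc, hct⟩ := ghostSum_commutator hp hp2 hq hg m b
  refine ⟨c + (a * b - b * a), ?_, fun t ht => ?_⟩
  · have h : b * ((p : A) ^ m * a) = (p : A) ^ m * (b * a) := by
      rw [← mul_assoc, ← mul_assoc, ((Nat.cast_commute p b).pow_left m).eq]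
    rw [mul_add b, h, mul_add ((p : A) ^ m), ← hc, add_mul, mul_sub, mul_assoc]
    abel
  · rw [map_add, hct t ht, map_sub, map_mul, map_mul, ht, Algebra.commutes, sub_self, add_zero]

variable {I : Ideal A}

/-- `z` commutes with everything modulo `p ^ m` and `I`. -/
def CommutesMod (p : ℕ) (I : Ideal A) (m : ℕ) (z : A) : Prop :=
  ∀ b, ∃ c, z * b - b * z - (p : A) ^ m * c ∈ I

theorem IsFlatTwoSided.commutesMod (hI : IsFlatTwoSided p n I) {z : A} (hz : z ∈ I) (m : ℕ) :
    CommutesMod p I m z := fun b => ⟨0, by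
  rw [mul_zero, sub_zero]
  exact I.sub_mem (hI.mul_mem z hz b) (I.mul_mem_left b hz)⟩

theorem CommutesMod.sub {m : ℕ} {y z : A} (hy : CommutesMod p I m y) (hz : CommutesMod p I m z) :
    CommutesMod p I m (y - z) := fun b => by
  obtain ⟨c, hc⟩ := hy b
  obtain ⟨d, hd⟩ := hz b
  refine ⟨c - d, ?_⟩
  have := I.sub_mem hc hd
  convert this using 1
  noncomm_ring

theorem CommutesMod.mono {m m' : ℕ} (h : m ≤ m') {z : A} (hz : CommutesMod p I m' z) :
    CommutesMod p I m z := fun b => by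
  obtain ⟨c, hc⟩ := hz b
  exact ⟨(p : A) ^ (m' - m) * c, by rwa [← mul_assoc, ← pow_add, Nat.add_sub_cancel' h]⟩

theorem IsFlatTwoSided.exists_mul_eq (hq : IsQuantization p n br π) (hI : IsFlatTwoSided p n I)
    (hn : 0 < n) {a : A} (ha : (p : A) * a ∈ I) : ∃ y ∈ I, (p : A) * a = p * y := by
  obtain ⟨y, hy, h⟩ := hI.exists_eq_pow_mul (n - 1) _ ha (by
    rw [← mul_assoc, ← pow_succ, Nat.sub_add_cancel hn, hq.pow_eq_zero, zero_mul])
  rw [Nat.sub_sub_self hn, pow_one] at h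
  exact ⟨y, hy, h⟩

theorem IsFlatTwoSided.exists_sub_pow_mul_mem (hq : IsQuantization p n br π)
    (hI : IsFlatTwoSided p n I) (hn : 0 < n) {a : A} (ha : (p : A) * a ∈ I) :
    ∃ b, a - (p : A) ^ (n - 1) * b ∈ I := by
  obtain ⟨y, hy, h⟩ := hI.exists_mul_eq hq hn ha
  obtain ⟨b, hb⟩ := hq.exists_eq_pow_mul 1 (a - y) (by rw [pow_one, mul_sub, h, sub_self])
  exact ⟨b, by rwa [← hb, sub_sub_cancel]⟩

theorem IsFlatTwoSided.exists_map_eq (hq : IsQuantization p n br π)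
    (hI : IsFlatTwoSided p n I) {m : ℕ} (hm : m < n) {a : A} (ha : (p : A) ^ m * a ∈ I) :
    ∃ y ∈ I, π y = π a := by
  obtain ⟨y, hy, h⟩ := hI.exists_eq_pow_mul (n - m) _ ha (by
    rw [← mul_assoc, ← pow_add, Nat.sub_add_cancel hm.le, hq.pow_eq_zero, zero_mul])
  rw [Nat.sub_sub_self hm.le] at h
  obtain ⟨b, hb⟩ := hq.exists_eq_pow_mul m (a - y) (by rw [mul_sub, h, sub_self])
  refine ⟨y, hy, ?_⟩
  rw [eq_comm, ← sub_eq_zero, ← map_sub, hb, map_mul, map_pow, hq.map_natCast_eq_zero,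
    zero_pow (by omega), zero_mul]

/-- The reduction of `I` modulo `p`, intersected with `S`. -/
def Ideal.centralReduction (S : Type*) [CommRing S] [Algebra S B] (π : A →+* B) (I : Ideal A) :
    Ideal S :=
  (I.map π).comap (algebraMap S B)

theorem IsQuantization.mem_map_iff (hq : IsQuantization p n br π) {b : B} :
    b ∈ I.map π ↔ ∃ x ∈ I, π x = b :=
  Ideal.mem_map_iff_of_surjective π hq.surjective

theorem IsQuantization.mem_centralReduction (hq : IsQuantization p n br π) {f : S} :
    f ∈ I.centralReduction S π ↔ ∃ x ∈ I, π x = algebraMap S B f := by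
  rw [Ideal.centralReduction, Ideal.mem_comap, hq.mem_map_iff]

theorem IsQuantization.map_mul_mem (hq : IsQuantization p n br π) (hI : IsFlatTwoSided p n I) :
    ∀ x ∈ I.map π, ∀ a, x * a ∈ I.map π := by
  intro x hx a
  obtain ⟨y, hy, rfl⟩ := hq.mem_map_iff.1 hx
  obtain ⟨a, rfl⟩ := hq.surjective a
  exact hq.mem_map_iff.2 ⟨y * a, hI.mul_mem y hy a, map_mul π y a⟩

/-- If `f ^ p ^ m + p * y` is central modulo `p ^ (m + 1)` and `I`, then `y` is central modulo
`p ^ m` and `I`. -/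
theorem CommutesMod.of_pow_add (hp : p.Prime) (hp2 : 2 < p) (hq : IsQuantization p n br π)
    (hI : IsFlatTwoSided p n I) {m : ℕ} (hm : m < n) {f y : A} {t : S}
    (hf : π f = algebraMap S B t) (h : CommutesMod p I (m + 1) (f ^ p ^ m + p * y)) :
    CommutesMod p I m y := by
  intro b
  obtain ⟨c, hc⟩ := h b
  obtain ⟨d, hd⟩ := hq.exists_commutator hf b
  obtain ⟨e, he⟩ := exists_pow_prime_pow_commutator hp hp2 (hq.exists_commutator hf) m hd
  generalize d * f ^ (p ^ m - 1) + p * e = u at he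
  have h1 : (p : A) * (y * b - b * y - (p : A) ^ m * (c - u)) ∈ I := by
    convert hc using 1
    have h2 : b * (p * y) = p * (b * y) := by
      rw [← mul_assoc, ← mul_assoc, (Nat.cast_commute p b).eq]
    have h3 : (f ^ p ^ m + p * y) * b - b * (f ^ p ^ m + p * y) =
        (f ^ p ^ m * b - b * f ^ p ^ m) + p * (y * b - b * y) := by
      rw [mul_add, add_mul, h2, mul_sub, mul_assoc]
      abel
    rw [h3, he, pow_succ']
    noncomm_ring
  obtain ⟨w, hw⟩ := hI.exists_sub_pow_mul_mem hq (by omega) h1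
  refine ⟨c - u + (p : A) ^ (n - 1 - m) * w, ?_⟩
  rwa [mul_add, ← mul_assoc, ← pow_add, Nat.add_sub_cancel' (by omega), ← sub_sub]

theorem IsQuantization.exists_isGhost_one (hq : IsQuantization p n br π)
    (hI : IsFlatTwoSided p n I) (hAz : IsAzumayaOver S B) {z : A} (hz : CommutesMod p I 1 z) :
    ∃ (s : ℕ → S) (x : A), IsGhost p π 1 s x ∧ z - x ∈ I := by
  obtain ⟨s, hs⟩ := hAz.exists_sub_algebraMap_mem (hq.map_mul_mem hI) (y := π z) fun b => by
    obtain ⟨b, rfl⟩ := hq.surjective b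
    obtain ⟨c, hc⟩ := hz b
    have := Ideal.mem_map_of_mem π hc
    simpa [hq.map_natCast_eq_zero] using this
  obtain ⟨i, hi, h⟩ := hq.mem_map_iff.1 hs
  obtain ⟨f, hf⟩ := hq.surjective (algebraMap S B s)
  obtain ⟨a, ha⟩ := hq.exists_eq_add (x := z - i) (y := f) (by rw [map_sub, h, hf, sub_sub_cancel])
  refine ⟨_, _, (isGhost_zero (S := S) (π := π) a).pow_add hf, ?_⟩
  rw [pow_zero, pow_one, ← ha, sub_sub_cancel]
  exact hi

/-- Every `z` central modulo `p ^ m` and `I` is congruent to a ghost element modulo `I`. -/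
def CentralLiftsGhost (S : Type*) [CommRing S] [Algebra S B] (p : ℕ) (π : A →+* B) (I : Ideal A)
    (m : ℕ) : Prop :=
  ∀ z, CommutesMod p I m z → ∃ (s : ℕ → S) (x : A), IsGhost p π m s x ∧ z - x ∈ I

theorem CentralLiftsGhost.exists_isGhost_of_pow_add (hp : p.Prime) (hp2 : 2 < p)
    (hq : IsQuantization p n br π) (hI : IsFlatTwoSided p n I) {m : ℕ} (hm : m < n)
    (h : CentralLiftsGhost S p π I m) {f y : A} {t : S} (hf : π f = algebraMap S B t)
    (hy : CommutesMod p I (m + 1) (f ^ p ^ m + p * y)) :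
    ∃ (s : ℕ → S) (x : A), IsGhost p π (m + 1) s x ∧ s m = t ∧ f ^ p ^ m + p * y - x ∈ I := by
  obtain ⟨s, x, hx, hxI⟩ := h y (hy.of_pow_add hp hp2 hq hI hm hf)
  refine ⟨_, _, hx.pow_add hf, Function.update_self _ _ _, ?_⟩
  rw [add_sub_add_left_eq_sub, ← mul_sub]
  exact I.mul_mem_left _ hxI

theorem CentralLiftsGhost.exists_mem (hp : p.Prime) (hp2 : 2 < p)
    (hq : IsQuantization p n br π) (hI : IsFlatTwoSided p n I) {m : ℕ} (hm : m < n)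
    (h : CentralLiftsGhost S p π I m) {f : S} (hf : f ^ p ^ m ∈ I.centralReduction S π) :
    ∃ (s : ℕ → S) (x : A), IsGhost p π (m + 1) s x ∧ s m = f ∧ x ∈ I := by
  obtain ⟨f', hf'⟩ := hq.surjective (algebraMap S B f)
  obtain ⟨i, hi, hif⟩ := hq.mem_centralReduction.1 hf
  obtain ⟨y, rfl⟩ := hq.exists_eq_add (x := i) (y := f' ^ p ^ m) (by
    rw [hif, map_pow, map_pow, hf'])
  obtain ⟨s, x, hx, hs, hxI⟩ := h.exists_isGhost_of_pow_add hp hp2 hq hI hm hf'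
    (hI.commutesMod hi _)
  have := I.sub_mem hi hxI
  rw [sub_sub_cancel] at this
  exact ⟨s, x, hx, hs, this⟩

end Ideal

section Smooth

variable {p n : ℕ} [Fact p.Prime] {k S : Type u} [Field k] [CharP k p] [CommRing S]
  [Algebra k S] [CharP S p] {B A : Type*} [Ring B] [Algebra S B] [Ring A]
  {P : SymplecticPoisson k S} {π : A →+* B} {I : Ideal A}

theorem IsGhost.derivation_mem (hp2 : 2 < p) (hq : IsQuantization p n P.bracket π)
    (hI : IsFlatTwoSided p n I) {m : ℕ} (hm : m + 1 < n)
    (hJ : ∀ i < m, ((I.centralReduction S π).comap (iterateFrobenius S p i)).IsDifferential k)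
    {s : ℕ → S} {x : A} (hx : IsGhost p π (m + 1) s x) (hxI : CommutesMod p I (m + 2) x)
    (D : Derivation k S S) :
    D (s m) ∈ (I.centralReduction S π).comap (iterateFrobenius S p m) := by
  refine Ideal.derivation_mem_comap_iterateFrobenius m hJ
    (P.sum_derivation_mem fun t => ?_) D
  obtain ⟨b, hb⟩ := hq.surjective (algebraMap S B t)
  obtain ⟨c, hc, hct⟩ := hx.commutator Fact.out hp2 hq b
  obtain ⟨d, hd⟩ := hxI b
  rw [hc, pow_succ _ (m + 1), mul_assoc, ← mul_sub] at hd
  obtain ⟨y, hy, h⟩ := hI.exists_map_eq hq hm hd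
  refine hq.mem_centralReduction.2 ⟨y, hy, ?_⟩
  rw [h, map_sub, map_mul, hq.map_natCast_eq_zero, zero_mul, sub_zero, hct t hb]

variable [PerfectRing k p] [Algebra.FiniteType k S] [Algebra.FormallySmooth k S]

theorem IsQuantization.centralLiftsGhost (hp2 : 2 < p) (hq : IsQuantization p n P.bracket π)
    (hI : IsFlatTwoSided p n I) (hAz : IsAzumayaOver S B) (m : ℕ) (hm : m < n) :
    CentralLiftsGhost S p π I (m + 1) ∧ CentralLiftsGhost S p π I m ∧
      ∀ i < m,
        ((I.centralReduction S π).comap (iterateFrobenius S p i)).IsDifferential k := by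
  have hp : p.Prime := Fact.out
  induction m with
  | zero =>
    exact ⟨fun z hz => hq.exists_isGhost_one hI hAz hz,
      fun z _ => ⟨_, z, isGhost_zero z, by simp⟩, fun i hi => absurd hi (Nat.not_lt_zero i)⟩
  | succ m ih =>
    obtain ⟨h1, h0, hJ⟩ := ih (Nat.lt_of_succ_lt hm)
    have hJm : ((I.centralReduction S π).comap (iterateFrobenius S p m)).IsDifferential k := by
      intro D f hf
      rw [Ideal.mem_comap_iterateFrobenius] at hf
      obtain ⟨s, x, hx, rfl, hxI⟩ := h0.exists_mem hp hp2 hq hI (Nat.lt_of_succ_lt hm) hf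
      exact hx.derivation_mem hp2 hq hI hm hJ (hI.commutesMod hxI _) D
    refine ⟨fun z hz => ?_, h1, fun i hi => ?_⟩
    · obtain ⟨s, x, hx, hzx⟩ := h1 z (hz.mono (Nat.le_succ _))
      have hxI : CommutesMod p I (m + 2) x := by
        have := hz.sub (hI.commutesMod hzx _)
        rwa [sub_sub_cancel] at this
      obtain ⟨g, hg⟩ := hJm.exists_sub_pow_char_mem p
        (hx.derivation_mem hp2 hq hI hm hJ hxI)
      rw [Ideal.mem_comap_iterateFrobenius, sub_pow_char_pow, ← pow_mul, ← pow_succ'] at hg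
      obtain ⟨i, hi, hig⟩ := hq.mem_centralReduction.1 hg
      obtain ⟨f, hf⟩ := hq.surjective (algebraMap S B g)
      obtain ⟨y, hy⟩ := hq.exists_eq_add (x := x - i) (y := f ^ p ^ (m + 1)) (by
        rw [map_sub, hx.map_eq hq, hig, map_sub, sub_sub_cancel, map_pow, map_pow, hf])
      obtain ⟨s', x', hx', _, hxI'⟩ := h1.exists_isGhost_of_pow_add hp hp2 hq hI hm (y := y) hf (by
        rw [← hy]
        exact hxI.sub (hI.commutesMod hi _))
      refine ⟨s', x', hx', ?_⟩
      have := I.add_mem (I.add_mem hzx hi) hxI'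
      rw [← hy] at this
      convert this using 1
      abel
    · rcases Nat.lt_succ_iff_lt_or_eq.1 hi with hi | rfl
      · exact hJ i hi
      · exact hJm

theorem IsQuantization.eq_span_center (hp2 : 2 < p) (hn : 0 < n)
    (hq : IsQuantization p n P.bracket π) (hI : IsFlatTwoSided p n I) (hAz : IsAzumayaOver S B) :
    I = Ideal.span ((I : Set A) ∩ (Subring.center A : Set A)) := by
  have hp : p.Prime := Fact.out
  obtain ⟨m, rfl⟩ : ∃ m, n = m + 1 := ⟨n - 1, by omega⟩
  obtain ⟨_, hm, hJ⟩ := hq.centralLiftsGhost hp2 hI hAz m (Nat.lt_succ_self m)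
  set L := Ideal.span ((I : Set A) ∩ (Subring.center A : Set A)) with hL
  have hLI : L ≤ I := Ideal.span_le.2 Set.inter_subset_left
  have hpow : ∀ h ∈ {h | h ∈ I.centralReduction S π ∧ ∃ g, h = g ^ p ^ m},
      algebraMap S B h ∈ L.map π := by
    rintro _ ⟨hf, f, rfl⟩
    obtain ⟨s, x, hx, rfl, hxI⟩ := hm.exists_mem hp hp2 hq hI (Nat.lt_succ_self m) hf
    rw [← hx.map_eq hq]
    refine Ideal.mem_map_of_mem π (Ideal.subset_span ⟨hxI, Subring.mem_center_iff.2 fun b => ?_⟩)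
    obtain ⟨c, hc, _⟩ := hx.commutator hp hp2 hq b
    rw [hq.pow_eq_zero, zero_mul, sub_eq_zero] at hc
    exact hc.symm
  have hcentral : ∀ f ∈ I.centralReduction S π, algebraMap S B f ∈ L.map π := by
    have : I.centralReduction S π ≤ (L.map π).comap (algebraMap S B) :=
      (Ideal.mem_span_pow_of_isDifferential m hJ).trans (Ideal.span_le.2 hpow)
    exact fun f hf => this hf
  have hmap : I.map π ≤ L.map π := fun b hb => by
    have h := hAz.mem_span_algebraMap (hq.map_mul_mem hI) hb
    refine Ideal.span_le.2 ?_ h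
    rintro _ ⟨f, hf, rfl⟩
    exact hcentral f hf
  have hiter : ∀ j : ℕ, ∀ x ∈ I, ∃ x' ∈ I, x - (p : A) ^ j * x' ∈ L := by
    intro j
    induction j with
    | zero => exact fun x hx => ⟨x, hx, by simp⟩
    | succ j ih =>
      intro x hx
      obtain ⟨x', hx', h⟩ := ih x hx
      obtain ⟨y, hy, hyx⟩ := hq.mem_map_iff.1 (hmap (Ideal.mem_map_of_mem π hx'))
      obtain ⟨a, ha⟩ := hq.exists_eq_add hyx.symm
      obtain ⟨x'', hx'', hax⟩ := hI.exists_mul_eq hq hn (a := a) (by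
        have := I.sub_mem hx' (hLI hy)
        rwa [ha, add_sub_cancel_left] at this)
      refine ⟨x'', hx'', ?_⟩
      have := L.add_mem h (L.mul_mem_left ((p : A) ^ j) hy)
      convert this using 1
      rw [ha, hax, pow_succ, mul_add, mul_assoc]
      abel
  refine le_antisymm (fun x hx => ?_) hLI
  obtain ⟨x', _, h⟩ := hiter (m + 1) x hx
  rwa [hq.pow_eq_zero, zero_mul, sub_zero] at h

end Smooth

/-- Let `k` be a perfect field of characteristic `p > 2`, `S` a smooth affine
`k`-algebra with a symplectic Poisson structure, and `A₁` an Azumaya algebra over `S` with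
`Z(A₁) = S` (the embedding `S → A₁` maps onto the center of `A₁`). Let `A` be a deformation
quantization of `A₁` over `W_n(k)` (`n ≥ 1`), with the structural isomorphism `A/pA ≅ A₁`
encoded by the surjective homomorphism `π : A → A₁` with kernel `pA`. Then every two-sided
ideal `I` of `A` which is flat as a `W_n(k)`-module is generated by its central elements:
`I = (I ∩ Z(A))·A`. -/
theorem stmt_0 (p : ℕ) [Fact p.Prime] (hp : 2 < p)
    (k : Type u) [Field k] [CharP k p] [ExpChar k p] [PerfectRing k p]
    (S : Type u) [CommRing S] [Algebra k S]
    (hfg : Algebra.FiniteType k S) [Algebra.FormallySmooth k S]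
    (P : SymplecticPoisson k S)
    (A₁ : Type*) [Ring A₁] [Algebra k A₁] [Algebra S A₁] [IsScalarTower k S A₁]
    (hinj : Function.Injective (algebraMap S A₁))
    (hcen : Set.range (algebraMap S A₁) = (Subring.center A₁ : Set A₁))
    (hAz : IsAzumayaOver S A₁)
    (n : ℕ) (hn : 0 < n)
    (A : Type*) [Ring A] [Algebra (TruncatedWittVector p n k) A]
    [Module.Flat (TruncatedWittVector p n k) A]
    (π : A →+* A₁) (hsurj : Function.Surjective π)
    (hker : ∀ a : A, π a = 0 ↔ ∃ b : A, a = (p : A) * b)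
    (hcompat : ∀ w : TruncatedWittVector p n k,
      π (algebraMap (TruncatedWittVector p n k) A w) =
        algebraMap k A₁ (TruncatedWittVector.coeff ⟨0, hn⟩ w))
    (hbr : ∀ (a b : A) (s t : S), π a = algebraMap S A₁ s → π b = algebraMap S A₁ t →
      ∃ c : A, (p : A) * c = a * b - b * a ∧ π c = algebraMap S A₁ (P.bracket s t))
    (I : Ideal A) (hI2 : ∀ x ∈ I, ∀ a : A, x * a ∈ I)
    (hIflat : Module.Flat (TruncatedWittVector p n k)
      (I.restrictScalars (TruncatedWittVector p n k))) :
    I = Ideal.span ((I : Set A) ∩ (Subring.center A : Set A)) := by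
  have hpA : (p : A) ^ n = 0 := by
    have := congrArg (algebraMap (TruncatedWittVector p n k) A)
      (TruncatedWittVector.natCast_pow_eq_zero p k n)
    simpa using this
  rcases subsingleton_or_nontrivial S with hS | hS
  · have h1 : π 1 = 0 := by
      rw [map_one, ← map_one (algebraMap S A₁), Subsingleton.elim (1 : S) 0, map_zero]
    obtain ⟨b, hb⟩ := (hker 1).1 h1
    have h2 : ∀ m : ℕ, (1 : A) = (p : A) ^ m * b ^ m := by
      intro m
      rw [← ((Nat.cast_commute p b).mul_pow m), ← hb, one_pow]
    have h3 : (1 : A) = 0 := by rw [h2 n, hpA, zero_mul]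
    have := subsingleton_of_zero_eq_one h3.symm
    exact Subsingleton.elim _ _
  · have := charP_of_injective_algebraMap (FaithfulSMul.algebraMap_injective k S) p
    have hq : IsQuantization p n P.bracket π :=
      { algebraMap_injective := hinj
        surjective := hsurj
        map_eq_zero_iff := hker
        pow_eq_zero := hpA
        exists_eq_pow_mul := fun i a ha => by
          obtain ⟨b, hb⟩ := exists_eq_pow_smul_of_flat (p := p) (k := k) (n := n) (i := i) (x := a)
            (by rw [nsmul_eq_mul, Nat.cast_pow, ha])
          exact ⟨b, by rw [hb, nsmul_eq_mul, Nat.cast_pow]⟩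
        bracket := hbr }
    have hI : IsFlatTwoSided p n I :=
      { mul_mem := hI2
        exists_eq_pow_mul := fun i x hx h => by
          obtain ⟨⟨y, hyI⟩, hy⟩ := exists_eq_pow_smul_of_flat (p := p) (k := k) (n := n) (i := i)
            (x := (⟨x, hx⟩ : I.restrictScalars (TruncatedWittVector p n k)))
            (Subtype.ext (by
              change (p ^ i : ℕ) • x = 0
              rw [nsmul_eq_mul, Nat.cast_pow, h]))
          refine ⟨y, hyI, ?_⟩
          have := congrArg Subtype.val hy
          change x = (p ^ (n - i) : ℕ) • y at this
          rwa [nsmul_eq_mul, Nat.cast_pow] at this }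
    exact hq.eq_span_center hp hn hI hAz
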